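/- There exist constants C₁, C₂ > 0 such that for all integers m, n with 2 ≤ m ≤ n, the probability π(m,n) that a random game G(m,n) is strict-dominance solvable satisfies n^{−(m−1)} ≤ π(m,n) ≤ C₁·n^{−C₂·m}. -/

import Mathlib

open Finset Filter

noncomputable section

/-- Row action `i` is strictly dominated in the restricted game with Row actions `X`
and Column actions `Y`, for Row payoff matrix `R`. -/
def RowDomIn {m n : ℕ} (R : Fin m → Fin n → ℝ) (X : Finset (Fin m)) (Y : Finset (Fin n))
    (i : Fin m) : Prop :=
  ∃ i' ∈ X, ∀ j ∈ Y, R i j < R i' j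

/-- Column action `j` is strictly dominated in the restricted game with Row actions `X`
and Column actions `Y`, for Column payoff matrix `C`. -/
def ColDomIn {m n : ℕ} (C : Fin m → Fin n → ℝ) (X : Finset (Fin m)) (Y : Finset (Fin n))
    (j : Fin n) : Prop :=
  ∃ j' ∈ Y, ∀ i ∈ X, C i j < C i j'

open Classical in
/-- One round of iterated elimination: simultaneously delete every strictly dominated
action of both players in the current restricted game. -/
def elimStep {m n : ℕ} (R C : Fin m → Fin n → ℝ)
    (p : Finset (Fin m) × Finset (Fin n)) : Finset (Fin m) × Finset (Fin n) :=
  (p.1.filter fun i => ¬ RowDomIn R p.1 p.2 i,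
   p.2.filter fun j => ¬ ColDomIn C p.1 p.2 j)

/-- Surviving actions of the subgame `(p.1, p.2)` after iterated elimination of strictly
dominated actions (iterating `m + n` times surely reaches the fixed point). -/
def survivorsFrom {m n : ℕ} (R C : Fin m → Fin n → ℝ)
    (p : Finset (Fin m) × Finset (Fin n)) : Finset (Fin m) × Finset (Fin n) :=
  (elimStep R C)^[m + n] p

/-- The subgame `(p.1, p.2)` is strict-dominance solvable: exactly one action of each
player survives iterated elimination of strictly dominated actions. -/
def SolvableFrom {m n : ℕ} (R C : Fin m → Fin n → ℝ)
    (p : Finset (Fin m) × Finset (Fin n)) : Prop :=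
  (survivorsFrom R C p).1.card = 1 ∧ (survivorsFrom R C p).2.card = 1

/-- Surviving actions of the full game after iterated elimination. -/
def survivors {m n : ℕ} (R C : Fin m → Fin n → ℝ) : Finset (Fin m) × Finset (Fin n) :=
  survivorsFrom R C (Finset.univ, Finset.univ)

/-- The game is strict-dominance solvable. -/
def Solvable {m n : ℕ} (R C : Fin m → Fin n → ℝ) : Prop :=
  SolvableFrom R C (Finset.univ, Finset.univ)

/-- The number of rounds performed by the iterated elimination procedure:
the least `k` such that round `k + 1` deletes nothing more. -/
def elimRounds {m n : ℕ} (R C : Fin m → Fin n → ℝ) : ℕ :=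
  sInf {k | (elimStep R C)^[k + 1] (Finset.univ, Finset.univ)
          = (elimStep R C)^[k] (Finset.univ, Finset.univ)}

/-- Sample space of the random game `G(m,n)`: for each Column action an i.i.d. uniform
permutation giving Row's ordinal payoffs in that column, and for each Row action an
i.i.d. uniform permutation giving Column's ordinal payoffs in that row. -/
abbrev Omega (m n : ℕ) := (Fin n → Equiv.Perm (Fin m)) × (Fin m → Equiv.Perm (Fin n))

/-- Row's payoff matrix of the realized game. -/
def RPay {m n : ℕ} (ω : Omega m n) : Fin m → Fin n → ℝ := fun i j => ((ω.1 j) i : ℕ)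

/-- Column's payoff matrix of the realized game. -/
def CPay {m n : ℕ} (ω : Omega m n) : Fin m → Fin n → ℝ := fun i j => ((ω.2 i) j : ℕ)

/-- Probability of an event under the uniform distribution on `Omega m n`
(i.e. all `m + n` permutations uniform and mutually independent). -/
def Pr {m n : ℕ} (E : Set (Omega m n)) : ℝ :=
  (E.toFinite.toFinset.card : ℝ) / (Fintype.card (Omega m n) : ℝ)

open Classical in
/-- Number of Row actions that are not strictly dominated. -/
def UR {m n : ℕ} (ω : Omega m n) : ℕ :=
  (Finset.univ.filter fun i => ¬ RowDomIn (RPay ω) Finset.univ Finset.univ i).card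

open Classical in
/-- Number of Column actions that are not strictly dominated. -/
def UC {m n : ℕ} (ω : Omega m n) : ℕ :=
  (Finset.univ.filter fun j => ¬ ColDomIn (CPay ω) Finset.univ Finset.univ j).card

/-- Number of Row actions surviving iterated elimination. -/
def SR {m n : ℕ} (ω : Omega m n) : ℕ := (survivors (RPay ω) (CPay ω)).1.card

/-- Number of Column actions surviving iterated elimination. -/
def SC {m n : ℕ} (ω : Omega m n) : ℕ := (survivors (RPay ω) (CPay ω)).2.card

/-- The realized game is strict-dominance solvable. -/
def GameSolvable {m n : ℕ} (ω : Omega m n) : Prop := Solvable (RPay ω) (CPay ω)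

/-- Number of rounds of the iterated elimination procedure in the realized game. -/
def GameRounds {m n : ℕ} (ω : Omega m n) : ℕ := elimRounds (RPay ω) (CPay ω)

/-- `π(m,n)`: probability that the random game `G(m,n)` is strict-dominance solvable. -/
def probSolvable (m n : ℕ) : ℝ := Pr {ω : Omega m n | GameSolvable ω}

/-- Expected number of Column's strictly undominated actions, `E[U^C(m,n)]`. -/
def expUC (m n : ℕ) : ℝ :=
  (∑ ω : Omega m n, (UC ω : ℝ)) / (Fintype.card (Omega m n) : ℝ)

/-- Expected number of Column actions surviving iterated elimination, `E[S^C(m,n)]`. -/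
def expSC (m n : ℕ) : ℝ :=
  (∑ ω : Omega m n, (SC ω : ℝ)) / (Fintype.card (Omega m n) : ℝ)

open Classical in
/-- `E[I(m,n)]`: expected number of elimination rounds conditional on the game being
strict-dominance solvable. -/
def condExpRounds (m n : ℕ) : ℝ :=
  (∑ ω : Omega m n, if GameSolvable ω then (GameRounds ω : ℝ) else 0) /
    (∑ ω : Omega m n, if GameSolvable ω then (1 : ℝ) else 0)

/-- Unsigned Stirling numbers of the first kind. -/
def stirling1 : ℕ → ℕ → ℕ
  | 0, 0 => 1
  | 0, _ + 1 => 0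
  | _ + 1, 0 => 0
  | n + 1, k + 1 => n * stirling1 n (k + 1) + stirling1 n k

end

open Classical in
/-- Swapping any one `d k` with its dominator gives disjoint translates of the event. -/
theorem succ_mul_card_dominated_le {a q : ℕ} (d f : Fin q → Fin a)
    (hd : Function.Injective d) (hf : ∀ k l, f k ≠ d l) :
    (q + 1) * #{σ : Equiv.Perm (Fin a) | ∀ k, σ (d k) < σ (f k)} ≤ a.factorial := by
  set A : Finset (Equiv.Perm (Fin a)) := {σ | ∀ k, σ (d k) < σ (f k)} with hA
  have key : ∀ σ ∈ A, ∀ ρ ∈ A, ∀ k l,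
      σ * Equiv.swap (d k) (f k) = ρ * Equiv.swap (d l) (f l) → k = l := by
    intro σ hσ ρ hρ k l h
    simp only [hA, mem_filter, mem_univ, true_and] at hσ hρ
    by_contra hkl
    have hdkl : d k ≠ d l := fun e => hkl (hd e)
    have hdk : σ (f k) = (ρ * Equiv.swap (d l) (f l)) (d k) := by rw [← h]; simp
    have hfk : σ (d k) = (ρ * Equiv.swap (d l) (f l)) (f k) := by rw [← h]; simp
    rw [Equiv.Perm.mul_apply, Equiv.swap_apply_of_ne_of_ne hdkl (hf l k).symm] at hdk
    have h1 := hσ k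
    by_cases hfe : f k = f l
    · have hdl : (σ * Equiv.swap (d k) (f k)) (d l) = ρ (f l) := by rw [h]; simp
      rw [Equiv.Perm.mul_apply, Equiv.swap_apply_of_ne_of_ne hdkl.symm (hf k l).symm] at hdl
      have h2 := hσ l
      have h3 := hρ k
      rw [hdl, ← hfe, hdk] at h2
      exact lt_asymm h2 h3
    · rw [Equiv.Perm.mul_apply, Equiv.swap_apply_of_ne_of_ne (hf k l) hfe] at hfk
      rw [hdk, hfk] at h1
      exact lt_asymm h1 (hρ k)
  have key' : ∀ σ ∈ A, ∀ ρ ∈ A, ∀ k, σ * Equiv.swap (d k) (f k) ≠ ρ := by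
    intro σ hσ ρ hρ k h
    simp only [hA, mem_filter, mem_univ, true_and] at hσ hρ
    have h1 := hρ k
    rw [← h] at h1
    simp only [Equiv.Perm.mul_apply, Equiv.swap_apply_left, Equiv.swap_apply_right] at h1
    exact lt_asymm h1 (hσ k)
  let g : Option (Fin q) × Equiv.Perm (Fin a) → Equiv.Perm (Fin a) := fun x =>
    x.1.elim x.2 fun k => x.2 * Equiv.swap (d k) (f k)
  have hinj : Set.InjOn g
      ((univ ×ˢ A : Finset (Option (Fin q) × Equiv.Perm (Fin a))) : Set _) := by
    rintro ⟨x, σ⟩ hσ ⟨y, ρ⟩ hρ h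
    simp only [coe_product, coe_univ, Set.mem_prod, Set.mem_univ, true_and, mem_coe] at hσ hρ
    rcases x with _ | k <;> rcases y with _ | l <;> simp only [g, Option.elim] at h
    · rw [h]
    · exact absurd h.symm (key' ρ hρ σ hσ l)
    · exact absurd h (key' σ hσ ρ hρ k)
    · obtain rfl := key σ hσ ρ hρ k l h
      rw [mul_right_cancel h]
  have := card_le_card_of_injOn (t := univ) g (fun _ _ => mem_univ _) hinj
  simpa [card_product, Fintype.card_perm] using this

open Classical in
theorem pow_mul_card_forall_mem_le {ι β : Type*} [Fintype ι] [Fintype β]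
    (A : Finset β) (Y : Finset ι) (c : ℕ) (h : c * #A ≤ Fintype.card β) :
    c ^ #Y * #{σ : ι → β | ∀ j ∈ Y, σ j ∈ A} ≤ Fintype.card β ^ Fintype.card ι := by
  have h1 : ({σ : ι → β | ∀ j ∈ Y, σ j ∈ A} : Finset (ι → β)) =
      Fintype.piFinset fun j => if j ∈ Y then A else univ := by
    ext σ
    simp only [mem_filter, mem_univ, true_and, Fintype.mem_piFinset]
    refine forall_congr' fun j => ?_
    by_cases hj : j ∈ Y <;> simp [hj]
  have h2 : c ^ #Y = ∏ j : ι, if j ∈ Y then c else 1 := by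
    rw [Finset.prod_ite_mem]; simp
  rw [h1, Fintype.card_piFinset, h2, ← prod_mul_distrib]
  calc _ ≤ ∏ j : ι, Fintype.card β := by
        refine prod_le_prod' fun j _ => ?_
        by_cases hj : j ∈ Y <;> simp [hj, h]
    _ = _ := by simp

open Classical in
/-- Union bound for the event that half of the rows are dominated on half of the columns. -/
theorem pow_mul_card_half_dominated_le {a b q s : ℕ} (hq : 2 * q ≤ a) (hs : 2 * s ≤ b + 1) :
    (q + 1) ^ s * #{σ : Fin b → Equiv.Perm (Fin a) | ∃ Y : Finset (Fin b), b < 2 * #Y ∧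
      ∃ X : Finset (Fin a), 2 * #X ≤ a ∧ ∀ i ∉ X, ∃ i' ∈ X, ∀ j ∈ Y, σ j i < σ j i'} ≤
    2 ^ b * (a ^ q * a ^ q) * a.factorial ^ b := by
  let T : Finset (Finset (Fin b) × (Fin q → Fin a) × (Fin q → Fin a)) :=
    {t | b < 2 * #t.1 ∧ Function.Injective t.2.1 ∧ ∀ k l, t.2.2 k ≠ t.2.1 l}
  let E : Finset (Fin b) × (Fin q → Fin a) × (Fin q → Fin a) →
      Finset (Fin b → Equiv.Perm (Fin a)) := fun t =>
    {σ | ∀ j ∈ t.1, σ j ∈ ({σ | ∀ k, σ (t.2.1 k) < σ (t.2.2 k)} : Finset (Equiv.Perm (Fin a)))}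
  have hsub : ({σ : Fin b → Equiv.Perm (Fin a) | ∃ Y : Finset (Fin b), b < 2 * #Y ∧
      ∃ X : Finset (Fin a), 2 * #X ≤ a ∧ ∀ i ∉ X, ∃ i' ∈ X, ∀ j ∈ Y, σ j i < σ j i'} :
      Finset _) ⊆ T.biUnion E := by
    intro σ hσ
    simp only [mem_filter, mem_univ, true_and] at hσ
    obtain ⟨Y, hY, X, hX, h⟩ := hσ
    have hc : q ≤ #Xᶜ := by
      rw [card_compl, Fintype.card_fin]; omega
    obtain ⟨D, hDX, hD⟩ := exists_subset_card_eq hc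
    let d : Fin q → Fin a := fun k => D.equivFin.symm (Fin.cast hD.symm k)
    have hdD : ∀ k, d k ∉ X := fun k =>
      mem_compl.1 (hDX (D.equivFin.symm (Fin.cast hD.symm k)).2)
    choose f hfX hf using fun k => h (d k) (hdD k)
    rw [mem_biUnion]
    refine ⟨(Y, d, f), ?_, ?_⟩
    · simp only [T, mem_filter, mem_univ, true_and]
      refine ⟨hY, ?_, fun k l e => hdD l (e ▸ hfX k)⟩
      intro k l hkl
      simpa [d] using hkl
    · simp only [E, mem_filter, mem_univ, true_and]
      exact fun j hj k => hf k j hj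
  have hE : ∀ t ∈ T, (q + 1) ^ s * #(E t) ≤ a.factorial ^ b := by
    intro t ht
    simp only [T, mem_filter, mem_univ, true_and] at ht
    have h1 := succ_mul_card_dominated_le t.2.1 t.2.2 ht.2.1 ht.2.2
    have h2 := pow_mul_card_forall_mem_le (ι := Fin b) _ t.1 (q + 1)
      (h1.trans_eq (by rw [Fintype.card_perm, Fintype.card_fin]))
    rw [Fintype.card_perm, Fintype.card_fin, Fintype.card_fin] at h2
    have hst : s ≤ #t.1 := by omega
    calc (q + 1) ^ s * #(E t) ≤ (q + 1) ^ #t.1 * #(E t) :=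
          Nat.mul_le_mul_right _ (Nat.pow_le_pow_right (Nat.succ_pos q) hst)
      _ ≤ a.factorial ^ b := by convert h2
  calc _ ≤ (q + 1) ^ s * ∑ t ∈ T, #(E t) :=
        Nat.mul_le_mul_left _ ((card_le_card hsub).trans card_biUnion_le)
    _ = ∑ t ∈ T, (q + 1) ^ s * #(E t) := mul_sum _ _ _
    _ ≤ #T * a.factorial ^ b := by
        rw [← smul_eq_mul]; exact sum_le_card_nsmul _ _ _ hE
    _ ≤ _ := by
        refine Nat.mul_le_mul_right _ ((card_le_univ T).trans_eq ?_)
        simp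

theorem one_sub_mul_sqrt_le {w x : ℝ} (hw : 0 ≤ w) (hx : 1 ≤ x) :
    (x - 1 / 2) * √(w / x) ≤ x * √(w / (x + 1)) := by
  have h : (x - 1 / 2) / x ≤ √(x / (x + 1)) := by
    apply Real.le_sqrt_of_sq_le
    rw [div_pow, div_le_div_iff₀ (by positivity) (by positivity)]
    nlinarith [sq_nonneg (x - 1), mul_nonneg (sub_nonneg.2 hx) (sub_nonneg.2 hx)]
  have h2 : √(w / (x + 1)) = √(w / x) * √(x / (x + 1)) := by
    rw [← Real.sqrt_mul (by positivity)]
    congr 1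
    field_simp
  rw [h2]
  have h3 := mul_le_mul_of_nonneg_left h (Real.sqrt_nonneg (w / x))
  rw [mul_div_assoc', div_le_iff₀ (by positivity)] at h3
  linarith

/-- Permutations of `Fin (n + 1)`, described by the image of `0` and the relative order
of the remaining values. -/
def insertPerm (n : ℕ) (x : Fin (n + 1) × Equiv.Perm (Fin n)) : Equiv.Perm (Fin (n + 1)) :=
  (finSuccEquiv n).trans ((Equiv.optionCongr x.2).trans (finSuccEquiv' x.1).symm)

theorem insertPerm_zero {n : ℕ} (x : Fin (n + 1) × Equiv.Perm (Fin n)) :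
    insertPerm n x 0 = x.1 := by
  simp [insertPerm]

theorem insertPerm_succ {n : ℕ} (x : Fin (n + 1) × Equiv.Perm (Fin n)) (j : Fin n) :
    insertPerm n x j.succ = x.1.succAbove (x.2 j) := by
  simp [insertPerm]

theorem insertPerm_bijective (n : ℕ) : Function.Bijective (insertPerm n) := by
  rw [Fintype.bijective_iff_injective_and_card]
  constructor
  · rintro ⟨v, e⟩ ⟨v', e'⟩ h
    have h0 : v = v' := by
      have := congrArg (fun τ : Equiv.Perm (Fin (n + 1)) => τ 0) h
      simpa [insertPerm_zero] using this
    subst h0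
    have : e = e' := by
      ext j
      have := congrArg (fun τ : Equiv.Perm (Fin (n + 1)) => τ j.succ) h
      simp only [insertPerm_succ] at this
      rw [Fin.succAbove_right_injective this]
    rw [this]
  · simp [Fintype.card_perm, Nat.factorial_succ]

open Classical in
/-- Positions whose value under `τ` exceeds all values at later positions. -/
def records {n : ℕ} (τ : Equiv.Perm (Fin n)) : Finset (Fin n) :=
  {j | ∀ j', j < j' → τ j' < τ j}

theorem succ_mem_records_insertPerm {n : ℕ} (x : Fin (n + 1) × Equiv.Perm (Fin n)) (j : Fin n) :
    j.succ ∈ records (insertPerm n x) ↔ j ∈ records x.2 := by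
  simp only [records, mem_filter, mem_univ, true_and]
  constructor
  · intro h j' hj'
    have := h j'.succ (Fin.succ_lt_succ_iff.2 hj')
    simpa [insertPerm_succ] using this
  · intro h j' hj'
    obtain ⟨k, rfl⟩ := Fin.exists_succ_eq.2 (Fin.ne_zero_of_lt hj')
    simpa [insertPerm_succ] using h k (Fin.succ_lt_succ_iff.1 hj')

theorem zero_mem_records_insertPerm {n : ℕ} (e : Equiv.Perm (Fin n)) :
    0 ∈ records (insertPerm n (Fin.last n, e)) := by
  simp only [records, mem_filter, mem_univ, true_and]
  intro j' hj'
  obtain ⟨k, rfl⟩ := Fin.exists_succ_eq.2 (Fin.ne_zero_of_lt hj')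
  rw [insertPerm_succ, insertPerm_zero]
  simp [Fin.castSucc_lt_last]

theorem card_records_insertPerm_sdiff {n : ℕ} (x : Fin (n + 1) × Equiv.Perm (Fin n))
    (W : Finset (Fin (n + 1))) :
    #(records x.2 \ ({j | j.succ ∈ W} : Finset (Fin n))) +
      (if 0 ∉ W ∧ x.1 = Fin.last n then 1 else 0) ≤ #(records (insertPerm n x) \ W) := by
  have h1 : (records x.2 \ ({j | j.succ ∈ W} : Finset (Fin n))).map (Fin.succEmb n) ⊆
      records (insertPerm n x) \ W := by
    intro j hj
    simp only [Finset.mem_map, Finset.mem_sdiff, mem_filter, mem_univ, true_and] at hj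
    obtain ⟨k, ⟨hk, hkW⟩, rfl⟩ := hj
    simp only [Finset.mem_sdiff]
    exact ⟨(succ_mem_records_insertPerm x k).2 hk, hkW⟩
  split_ifs with h
  · have h0 : (0 : Fin (n + 1)) ∉
        (records x.2 \ ({j | j.succ ∈ W} : Finset (Fin n))).map (Fin.succEmb n) := by
      simp [Fin.succ_ne_zero]
    rw [← card_map (Fin.succEmb n), ← card_insert_of_notMem h0]
    refine card_le_card (insert_subset ?_ h1)
    obtain ⟨v, e⟩ := x
    obtain ⟨hW, rfl⟩ := h
    exact Finset.mem_sdiff.2 ⟨zero_mem_records_insertPerm e, hW⟩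
  · rw [add_zero, ← card_map (Fin.succEmb n)]
    exact card_le_card h1

theorem sum_half_pow_records_le (n : ℕ) (W : Finset (Fin n)) :
    ∑ τ : Equiv.Perm (Fin n), (1 / 2 : ℝ) ^ #(records τ \ W) ≤
      n.factorial * √((#W + 1) / (n + 1)) := by
  induction n with
  | zero =>
    have : W = ∅ := Finset.eq_empty_of_isEmpty W
    subst this
    simp [Finset.eq_empty_of_isEmpty (records _)]
  | succ n ih =>
    set W' : Finset (Fin n) := {j | j.succ ∈ W} with hW'
    have hcard : #W' + (if 0 ∈ W then 1 else 0) = #W := by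
      have h1 : W.erase 0 = W'.map (Fin.succEmb n) := by
        ext j
        refine Fin.cases ?_ (fun k => ?_) j
        · simp
        · simp [hW', Fin.succ_ne_zero]
      split_ifs with h
      · rw [← card_map (Fin.succEmb n), ← h1, card_erase_add_one h]
      · rw [← card_map (Fin.succEmb n), ← h1, erase_eq_of_notMem h, add_zero]
    have hS := ih W'
    set S := ∑ τ : Equiv.Perm (Fin n), (1 / 2 : ℝ) ^ #(records τ \ W') with hSdef
    have hle : ∑ τ : Equiv.Perm (Fin (n + 1)), (1 / 2 : ℝ) ^ #(records τ \ W) ≤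
        ∑ v : Fin (n + 1), (1 / 2 : ℝ) ^ (if 0 ∉ W ∧ v = Fin.last n then 1 else 0) * S := by
      rw [← (insertPerm_bijective n).sum_comp fun τ => (1 / 2 : ℝ) ^ #(records τ \ W),
        Fintype.sum_prod_type]
      refine sum_le_sum fun v _ => ?_
      rw [hSdef, mul_sum]
      refine sum_le_sum fun e _ => ?_
      rw [← pow_add]
      refine pow_le_pow_of_le_one (by norm_num) (by norm_num) ?_
      rw [add_comm]
      exact card_records_insertPerm_sdiff (v, e) W
    refine hle.trans ?_
    have hn : (0 : ℝ) < n + 1 := by positivity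
    rw [Nat.factorial_succ]
    push_cast
    by_cases h : 0 ∈ W
    · simp only [h, not_true_eq_false, false_and, if_false, pow_zero, one_mul, sum_const,
        card_univ, Fintype.card_fin, nsmul_eq_mul]
      push_cast
      rw [if_pos h] at hcard
      have hw : #W ≤ n + 1 := (card_le_univ W).trans_eq (by simp)
      have h3 : √(((#W' : ℝ) + 1) / (n + 1)) ≤ √((#W + 1) / ((n : ℝ) + 1 + 1)) := by
        apply Real.sqrt_le_sqrt
        rw [div_le_div_iff₀ hn (by positivity)]
        have e1 : (#W' : ℝ) + 1 = #W := by exact_mod_cast hcard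
        have e2 : (#W : ℝ) ≤ n + 1 := by exact_mod_cast hw
        rw [e1]
        nlinarith
      rw [mul_assoc]
      refine mul_le_mul_of_nonneg_left (hS.trans ?_) hn.le
      exact mul_le_mul_of_nonneg_left h3 (by positivity)
    · rw [if_neg h, add_zero] at hcard
      have hsum : ∑ v : Fin (n + 1),
          (1 / 2 : ℝ) ^ (if 0 ∉ W ∧ v = Fin.last n then 1 else 0) * S =
          (n + 1 - 1 / 2) * S := by
        rw [← sum_mul, Fin.sum_univ_castSucc]
        simp [h, Fin.castSucc_ne_last]
        left
        ring
      rw [hsum]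
      calc ((n : ℝ) + 1 - 1 / 2) * S
          ≤ (n + 1 - 1 / 2) * (n.factorial * √((#W' + 1) / (n + 1))) :=
            mul_le_mul_of_nonneg_left hS (by linarith [(Nat.cast_nonneg n : (0 : ℝ) ≤ n)])
        _ = n.factorial * ((n + 1 - 1 / 2) * √((#W + 1) / (n + 1))) := by rw [hcard]; ring
        _ ≤ n.factorial * ((n + 1) * √((#W + 1) / (n + 1 + 1))) :=
            mul_le_mul_of_nonneg_left
              (one_sub_mul_sqrt_le (by positivity) (by linarith [(Nat.cast_nonneg n : (0 : ℝ) ≤ n)]))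
              (by positivity)
        _ = _ := by ring

/-- If each random set adds, in the sense of exponential moments, enough new elements to any
set of size at most `K`, then the union of `k` independent copies is large. -/
theorem sum_half_pow_union_le {T α : Type*} [Fintype T] [DecidableEq α] (r : T → Finset α)
    (K : ℕ) {B : ℝ} (hB : 0 ≤ B)
    (h : ∀ W : Finset α, #W ≤ K → ∑ τ, (1 / 2 : ℝ) ^ #(r τ \ W) ≤ B) (k : ℕ) (W : Finset α) :
    ∑ τ : Fin k → T, (if #(W ∪ univ.biUnion fun i => r (τ i)) ≤ K then
        (1 / 2 : ℝ) ^ #(W ∪ univ.biUnion fun i => r (τ i)) else 0) ≤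
      B ^ k * if #W ≤ K then (1 / 2 : ℝ) ^ #W else 0 := by
  induction k generalizing W with
  | zero => simp
  | succ k ih =>
    have hun : ∀ (t : T) (τ : Fin k → T),
        (W ∪ univ.biUnion fun i => r (Fin.cons (α := fun _ => T) t τ i)) =
        (W ∪ r t) ∪ univ.biUnion fun i => r (τ i) := by
      intro t τ
      ext x
      simp [Fin.exists_fin_succ]
    rw [← (Fin.consEquiv fun _ => T).sum_comp, Fintype.sum_prod_type]
    simp only [Fin.consEquiv, Equiv.coe_fn_mk, hun]
    calc _ ≤ ∑ t : T, B ^ k * (if #(W ∪ r t) ≤ K then (1 / 2 : ℝ) ^ #(W ∪ r t) else 0) :=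
          sum_le_sum fun t _ => ih (W ∪ r t)
      _ ≤ _ := by
        rw [← mul_sum, pow_succ, mul_assoc]
        refine mul_le_mul_of_nonneg_left ?_ (by positivity)
        split_ifs with hW
        · calc _ ≤ ∑ t : T, (1 / 2 : ℝ) ^ #(r t \ W) * (1 / 2 : ℝ) ^ #W := by
                refine sum_le_sum fun t _ => ?_
                rw [← pow_add, card_sdiff_add_card, union_comm]
                split_ifs
                · exact le_rfl
                · positivity
            _ ≤ _ := by
                rw [← sum_mul]
                exact mul_le_mul_of_nonneg_right (h W hW) (by positivity)
        · rw [mul_zero]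
          refine (sum_eq_zero fun t _ => if_neg fun h' => hW ?_).le
          exact (card_le_card subset_union_left).trans h'

theorem iterate_elimStep_succ {m n : ℕ} (R C : Fin m → Fin n → ℝ) (t : ℕ)
    (p : Finset (Fin m) × Finset (Fin n)) :
    (elimStep R C)^[t + 1] p = elimStep R C ((elimStep R C)^[t] p) :=
  Function.iterate_succ_apply' _ _ _

theorem mem_elimStep_fst {m n : ℕ} {R C : Fin m → Fin n → ℝ}
    {p : Finset (Fin m) × Finset (Fin n)} {i : Fin m} :
    i ∈ (elimStep R C p).1 ↔ i ∈ p.1 ∧ ¬ RowDomIn R p.1 p.2 i := by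
  simp [elimStep]

theorem mem_elimStep_snd {m n : ℕ} {R C : Fin m → Fin n → ℝ}
    {p : Finset (Fin m) × Finset (Fin n)} {j : Fin n} :
    j ∈ (elimStep R C p).2 ↔ j ∈ p.2 ∧ ¬ ColDomIn C p.1 p.2 j := by
  simp [elimStep]

/-- In a solvable game some row is dominated on the columns that are initially undominated. -/
theorem Solvable.exists_dominated {m n : ℕ} {R C : Fin m → Fin n → ℝ} (hm : 2 ≤ m)
    (h : Solvable R C) :
    ∃ i i', ∀ j, ¬ ColDomIn C univ univ j → R i j < R i' j := by
  by_contra! hno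
  have hinv : ∀ t, ((elimStep R C)^[t] (univ, univ)).1 = univ ∧
      ∀ j, ¬ ColDomIn C univ univ j → j ∈ ((elimStep R C)^[t] (univ, univ)).2 := by
    intro t
    induction t with
    | zero => simp
    | succ t ih =>
      rw [iterate_elimStep_succ]
      set p := (elimStep R C)^[t] (univ, univ)
      constructor
      · refine eq_univ_iff_forall.2 fun i => mem_elimStep_fst.2 ⟨ih.1 ▸ mem_univ i, ?_⟩
        rintro ⟨i', -, hi'⟩
        obtain ⟨j, hj, hle⟩ := hno i i'
        exact absurd (hi' j (ih.2 j hj)) (not_lt.2 hle)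
      · refine fun j hj => mem_elimStep_snd.2 ⟨ih.2 j hj, ?_⟩
        rintro ⟨j', -, hj'⟩
        exact hj ⟨j', mem_univ _, fun i hi => hj' i (ih.1 ▸ hi)⟩
  have h1 : ((elimStep R C)^[m + n] (univ, univ)).1.card = 1 := h.1
  rw [(hinv (m + n)).1, card_univ, Fintype.card_fin] at h1
  omega

/-- A dominated row is dominated by an undominated one. -/
theorem exists_undominated_dominating {m n : ℕ} {R : Fin m → Fin n → ℝ} {X : Finset (Fin m)}
    {Y : Finset (Fin n)} (hY : Y.Nonempty) {i : Fin m} (h : RowDomIn R X Y i) :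
    ∃ i' ∈ X, ¬ RowDomIn R X Y i' ∧ ∀ j ∈ Y, R i j < R i' j := by
  classical
  obtain ⟨j₀, hj₀⟩ := hY
  obtain ⟨i₁, hi₁, h₁⟩ := h
  obtain ⟨i', hi', hmax⟩ := exists_max_image (X.filter fun i' => ∀ j ∈ Y, R i j < R i' j)
    (fun i' => R i' j₀) ⟨i₁, mem_filter.2 ⟨hi₁, h₁⟩⟩
  rw [mem_filter] at hi'
  refine ⟨i', hi'.1, ?_, hi'.2⟩
  rintro ⟨i₂, hi₂, h₂⟩
  have := hmax i₂ (mem_filter.2 ⟨hi₂, fun j hj => (hi'.2 j hj).trans (h₂ j hj)⟩)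
  exact absurd (h₂ j₀ hj₀) (not_lt.2 this)

theorem dominated_of_not_mem_step {m n : ℕ} {R : Fin m → Fin n → ℝ} {X X' : Finset (Fin m)}
    {Y : Finset (Fin n)} (hY : Y.Nonempty)
    (hX' : ∀ i, i ∈ X' ↔ i ∈ X ∧ ¬ RowDomIn R X Y i)
    (hX : ∀ i ∉ X, ∃ i' ∈ X, ∀ j ∈ Y, R i j < R i' j) :
    ∀ i ∉ X', ∃ i' ∈ X', ∀ j ∈ Y, R i j < R i' j := by
  intro i hi
  have hdom : RowDomIn R X Y i := by
    by_cases hiX : i ∈ X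
    · by_contra hd
      exact hi ((hX' i).2 ⟨hiX, hd⟩)
    · exact hX i hiX
  obtain ⟨i', hi', hu, hd⟩ := exists_undominated_dominating hY hdom
  exact ⟨i', (hX' i').2 ⟨hi', hu⟩, hd⟩

/-- In a solvable game, half of one player's actions are dominated on half of the other's. -/
theorem Solvable.half_dominated {m n : ℕ} {R C : Fin m → Fin n → ℝ} (hm : 2 ≤ m)
    (h : Solvable R C) :
    (∃ Y : Finset (Fin n), n < 2 * #Y ∧ ∃ X : Finset (Fin m), 2 * #X ≤ m ∧
      ∀ i ∉ X, ∃ i' ∈ X, ∀ j ∈ Y, R i j < R i' j) ∨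
    (∃ X : Finset (Fin m), m < 2 * #X ∧ ∃ Y : Finset (Fin n), 2 * #Y ≤ n ∧
      ∀ j ∉ Y, ∃ j' ∈ Y, ∀ i ∈ X, C i j < C i j') := by
  by_contra! hno
  obtain ⟨hr, hc⟩ := hno
  have hn : 0 < n := by
    rcases Nat.eq_zero_or_pos n with rfl | hn
    · have := h.2
      rw [Finset.eq_empty_of_isEmpty (survivorsFrom R C _).2] at this
      simp at this
    · exact hn
  have hinv : ∀ t, let p := (elimStep R C)^[t] (univ, univ)
      (m < 2 * #p.1 ∧ n < 2 * #p.2) ∧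
      (∀ i ∉ p.1, ∃ i' ∈ p.1, ∀ j ∈ p.2, R i j < R i' j) ∧
      (∀ j ∉ p.2, ∃ j' ∈ p.2, ∀ i ∈ p.1, C i j < C i j') := by
    intro t
    induction t with
    | zero =>
      simp only [Function.iterate_zero, id, card_univ, Fintype.card_fin]
      refine ⟨⟨by omega, by omega⟩, fun i hi => absurd (mem_univ i) hi,
        fun j hj => absurd (mem_univ j) hj⟩
    | succ t ih =>
      simp only [iterate_elimStep_succ]
      set p := (elimStep R C)^[t] (univ, univ)
      obtain ⟨⟨hX, hY⟩, hR, hC⟩ := ih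
      have hXne : p.1.Nonempty := card_pos.1 (by omega)
      have hYne : p.2.Nonempty := card_pos.1 (by omega)
      have hR' := dominated_of_not_mem_step (X' := (elimStep R C p).1) hYne
        (fun i => mem_elimStep_fst) hR
      have hC' := dominated_of_not_mem_step (R := fun j i => C i j)
        (X' := (elimStep R C p).2) hXne (fun j => mem_elimStep_snd) hC
      refine ⟨⟨?_, ?_⟩, ?_, ?_⟩
      · by_contra hlt
        obtain ⟨i, hi, hi'⟩ := hr p.2 hY _ (not_lt.1 hlt)
        obtain ⟨i', hi'X, hd⟩ := hR' i hi
        obtain ⟨j, hj, hle⟩ := hi' i' hi'X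
        exact absurd (hd j hj) (not_lt.2 hle)
      · by_contra hlt
        obtain ⟨j, hj, hj'⟩ := hc p.1 hX _ (not_lt.1 hlt)
        obtain ⟨j', hj'Y, hd⟩ := hC' j hj
        obtain ⟨i, hi, hle⟩ := hj' j' hj'Y
        exact absurd (hd i hi) (not_lt.2 hle)
      · intro i hi
        obtain ⟨i', hi', hd⟩ := hR' i hi
        exact ⟨i', hi', fun j hj => hd j (mem_elimStep_snd.1 hj).1⟩
      · intro j hj
        obtain ⟨j', hj', hd⟩ := hC' j hj
        exact ⟨j', hj', fun i hi => hd i (mem_elimStep_fst.1 hi).1⟩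
  have h1 : #((elimStep R C)^[m + n] (univ, univ)).1 = 1 := h.1
  have h2 := (hinv (m + n)).1.1
  rw [h1] at h2
  omega

/-- A game with a column that dominates all others, and no ties for Row, is solvable. -/
theorem solvable_of_dominant_column {m n : ℕ} {R C : Fin m → Fin n → ℝ} (hm : 1 ≤ m)
    (hmn : 2 ≤ m + n) (j : Fin n) (hR : Function.Injective fun i => R i j)
    (hC : ∀ j', j' ≠ j → ∀ i, C i j' < C i j) : Solvable R C := by
  have : Nonempty (Fin m) := ⟨⟨0, hm⟩⟩
  obtain ⟨i, -, hi⟩ := exists_max_image univ (fun i => R i j) univ_nonempty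
  have hmem : ∀ t, i ∈ ((elimStep R C)^[t] (univ, univ)).1 ∧
      j ∈ ((elimStep R C)^[t] (univ, univ)).2 := by
    intro t
    induction t with
    | zero => simp
    | succ t ih =>
      rw [iterate_elimStep_succ]
      refine ⟨mem_elimStep_fst.2 ⟨ih.1, ?_⟩, mem_elimStep_snd.2 ⟨ih.2, ?_⟩⟩
      · rintro ⟨i', -, h⟩
        exact absurd (h j ih.2) (not_lt.2 (hi i' (mem_univ _)))
      · rintro ⟨j', -, h⟩
        have h1 := h i ih.1
        rcases eq_or_ne j' j with rfl | hj'
        · exact lt_irrefl _ h1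
        · exact lt_asymm h1 (hC j' hj' i)
  have hcol : ∀ t, ∀ j' ∈ ((elimStep R C)^[t + 1] (univ, univ)).2, j' = j := by
    intro t j' hj'
    rw [iterate_elimStep_succ, mem_elimStep_snd] at hj'
    by_contra hne
    exact hj'.2 ⟨j, (hmem t).2, fun i _ => hC j' hne i⟩
  have hrow : ∀ t, ∀ i' ∈ ((elimStep R C)^[t + 2] (univ, univ)).1, i' = i := by
    intro t i' hi'
    rw [iterate_elimStep_succ, mem_elimStep_fst] at hi'
    by_contra hne
    refine hi'.2 ⟨i, (hmem _).1, fun j' hj' => ?_⟩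
    rw [hcol t j' hj']
    exact lt_of_le_of_ne (hi i' (mem_univ _)) fun e => hne (hR e)
  obtain ⟨t, ht⟩ := Nat.exists_eq_add_of_le' hmn
  unfold Solvable SolvableFrom survivorsFrom
  rw [ht]
  exact ⟨card_eq_one.2 ⟨i, eq_singleton_iff_unique_mem.2 ⟨(hmem _).1, hrow t⟩⟩,
    card_eq_one.2 ⟨j, eq_singleton_iff_unique_mem.2 ⟨(hmem _).2, hcol (t + 1)⟩⟩⟩

theorem card_Omega (m n : ℕ) :
    Fintype.card (Omega m n) = m.factorial ^ n * n.factorial ^ m := by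
  simp [Omega, Fintype.card_perm]

theorem Pr_eq {m n : ℕ} (E : Set (Omega m n)) [DecidablePred (· ∈ E)] :
    Pr E = (#{ω | ω ∈ E} : ℝ) / (m.factorial ^ n * n.factorial ^ m) := by
  have : E.toFinite.toFinset = ({ω | ω ∈ E} : Finset (Omega m n)) := by ext; simp
  rw [Pr, card_Omega, this]
  push_cast
  rfl

theorem Pr_mono {m n : ℕ} {E F : Set (Omega m n)} (h : E ⊆ F) : Pr E ≤ Pr F := by
  classical
  rw [Pr_eq, Pr_eq]
  refine div_le_div_of_nonneg_right ?_ (by positivity)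
  exact_mod_cast card_le_card fun ω hω => by
    simp only [mem_filter, mem_univ, true_and] at hω ⊢
    exact h hω

theorem Pr_union_le {m n : ℕ} (E F : Set (Omega m n)) : Pr (E ∪ F) ≤ Pr E + Pr F := by
  classical
  rw [Pr_eq, Pr_eq, Pr_eq, ← add_div]
  refine div_le_div_of_nonneg_right ?_ (by positivity)
  rw [← Nat.cast_add, Nat.cast_le]
  refine (card_le_card fun ω hω => ?_).trans (card_union_le _ _)
  simpa using hω

theorem Pr_le_one {m n : ℕ} (E : Set (Omega m n)) : Pr E ≤ 1 := by
  classical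
  rw [Pr_eq]
  refine div_le_one_of_le₀ ?_ (by positivity)
  have := card_le_univ ({ω | ω ∈ E} : Finset (Omega m n))
  rw [card_Omega] at this
  exact_mod_cast this

theorem Pr_fst {m n : ℕ} (P : (Fin n → Equiv.Perm (Fin m)) → Prop) [DecidablePred P] :
    Pr {ω : Omega m n | P ω.1} = (#{σ | P σ} : ℝ) / m.factorial ^ n := by
  classical
  have : ({ω | ω ∈ {ω : Omega m n | P ω.1}} : Finset (Omega m n)) =
      ({σ | P σ} : Finset (Fin n → Equiv.Perm (Fin m))) ×ˢ univ := by
    ext; simp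
  rw [Pr_eq, this, card_product, card_univ, Fintype.card_fun, Fintype.card_perm,
    Fintype.card_fin, Fintype.card_fin]
  push_cast
  rw [mul_div_mul_right _ _ (by positivity)]

theorem Pr_snd {m n : ℕ} (P : (Fin m → Equiv.Perm (Fin n)) → Prop) [DecidablePred P] :
    Pr {ω : Omega m n | P ω.2} = (#{σ | P σ} : ℝ) / n.factorial ^ m := by
  classical
  have : ({ω | ω ∈ {ω : Omega m n | P ω.2}} : Finset (Omega m n)) =
      univ ×ˢ ({σ | P σ} : Finset (Fin m → Equiv.Perm (Fin n))) := by
    ext; simp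
  rw [Pr_eq, this, card_product, card_univ, Fintype.card_fun, Fintype.card_perm,
    Fintype.card_fin, Fintype.card_fin]
  push_cast
  rw [mul_div_mul_left _ _ (by positivity)]

theorem RPay_lt {m n : ℕ} (ω : Omega m n) (i i' : Fin m) (j : Fin n) :
    RPay ω i j < RPay ω i' j ↔ ω.1 j i < ω.1 j i' := by
  simp [RPay]

theorem CPay_lt {m n : ℕ} (ω : Omega m n) (i : Fin m) (j j' : Fin n) :
    CPay ω i j < CPay ω i j' ↔ ω.2 i j < ω.2 i j' := by
  simp [CPay]

/-- The two-sided union bound obtained by looking at the first half of the elimination. -/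
theorem probSolvable_le_of_two_mul_le {m n q s t : ℕ} (hm : 2 ≤ m) (hqm : 2 * q ≤ m)
    (hqn : 2 * q ≤ n) (hs : 2 * s ≤ n + 1) (ht : 2 * t ≤ m + 1) :
    probSolvable m n ≤ 2 ^ n * (m : ℝ) ^ (2 * q) / (q + 1) ^ s +
      2 ^ m * (n : ℝ) ^ (2 * q) / (q + 1) ^ t := by
  classical
  let PR : (Fin n → Equiv.Perm (Fin m)) → Prop := fun σ => ∃ Y : Finset (Fin n), n < 2 * #Y ∧
      ∃ X : Finset (Fin m), 2 * #X ≤ m ∧ ∀ i ∉ X, ∃ i' ∈ X, ∀ j ∈ Y, σ j i < σ j i'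
  let PC : (Fin m → Equiv.Perm (Fin n)) → Prop := fun σ => ∃ X : Finset (Fin m), m < 2 * #X ∧
      ∃ Y : Finset (Fin n), 2 * #Y ≤ n ∧ ∀ j ∉ Y, ∃ j' ∈ Y, ∀ i ∈ X, σ i j < σ i j'
  have hsub : {ω : Omega m n | GameSolvable ω} ⊆
      {ω : Omega m n | PR ω.1} ∪ {ω : Omega m n | PC ω.2} := by
    intro ω hω
    have := Solvable.half_dominated hm hω
    simp only [RPay_lt, CPay_lt] at this
    exact this
  refine (Pr_mono hsub).trans ((Pr_union_le _ _).trans (add_le_add ?_ ?_))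
  · rw [Pr_fst, div_le_div_iff₀ (by positivity) (by positivity), mul_comm, two_mul, pow_add]
    have := pow_mul_card_half_dominated_le hqm hs
    exact_mod_cast (by convert this)
  · rw [Pr_snd, div_le_div_iff₀ (by positivity) (by positivity), mul_comm, two_mul, pow_add]
    have := pow_mul_card_half_dominated_le hqn ht
    exact_mod_cast (by convert this)

open Classical in
/-- Columns that no column dominates against all rows. -/
def undominatedCols {m n : ℕ} (c : Fin m → Equiv.Perm (Fin n)) : Finset (Fin n) :=
  {j | ¬ ∃ j', ∀ i, c i j < c i j'}

open Classical in
theorem records_subset_undominatedCols {k n : ℕ} (c₀ : Equiv.Perm (Fin n))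
    (c : Fin k → Equiv.Perm (Fin n)) :
    (univ.biUnion fun i => (records (c i * c₀⁻¹)).map c₀⁻¹.toEmbedding) ⊆
      undominatedCols (Fin.cons c₀ c : Fin (k + 1) → Equiv.Perm (Fin n)) := by
  intro j hj
  simp only [mem_biUnion, mem_univ, true_and, Finset.mem_map, records, mem_filter] at hj
  obtain ⟨i, x, hx, rfl⟩ := hj
  simp only [undominatedCols, mem_filter, mem_univ, true_and]
  rintro ⟨j', hj'⟩
  have h0 := hj' 0
  have h1 := hj' i.succ
  simp only [Fin.cons_zero, Fin.cons_succ, Equiv.coe_toEmbedding, Equiv.Perm.inv_def,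
    Equiv.apply_symm_apply] at h0 h1
  have h2 := hx (c₀ j') h0
  simp only [Equiv.Perm.mul_apply, Equiv.Perm.inv_def, Equiv.symm_apply_apply] at h2
  exact lt_asymm h1 h2

theorem sum_half_pow_undominatedCols_le (k n K : ℕ) :
    ∑ c : Fin (k + 1) → Equiv.Perm (Fin n), (1 / 2 : ℝ) ^ #(undominatedCols c) ≤
      n.factorial ^ (k + 1) * ((1 / 2) ^ K + √((K + 1) / (n + 1)) ^ k) := by
  classical
  set ρ : ℝ := √((K + 1) / (n + 1))
  rw [← (Fin.consEquiv fun _ => Equiv.Perm (Fin n)).sum_comp, Fintype.sum_prod_type]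
  simp only [Fin.consEquiv, Equiv.coe_fn_mk]
  have hmain : ∀ c₀ : Equiv.Perm (Fin n),
      ∑ c : Fin k → Equiv.Perm (Fin n), (1 / 2 : ℝ) ^ #(undominatedCols
        (Fin.cons c₀ c : Fin (k + 1) → Equiv.Perm (Fin n))) ≤
      n.factorial ^ k * (1 / 2) ^ K + (n.factorial * ρ) ^ k := by
    intro c₀
    let r : Equiv.Perm (Fin n) → Finset (Fin n) := fun τ =>
      (records (τ * c₀⁻¹)).map c₀⁻¹.toEmbedding
    have hr : ∀ W : Finset (Fin n), #W ≤ K →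
        ∑ τ, (1 / 2 : ℝ) ^ #(r τ \ W) ≤ n.factorial * ρ := by
      intro W hW
      have he : ∀ τ, #(r τ \ W) = #(records (τ * c₀⁻¹) \ W.map c₀.toEmbedding) := by
        intro τ
        rw [← card_map (s := records (τ * c₀⁻¹) \ W.map c₀.toEmbedding) c₀⁻¹.toEmbedding,
          Finset.map_sdiff]
        congr 2
        ext x
        simp [Equiv.Perm.inv_def]
      simp only [he]
      refine (Equiv.sum_comp (Equiv.mulRight c₀⁻¹)
        fun τ => (1 / 2 : ℝ) ^ #(records τ \ W.map c₀.toEmbedding)).trans_le ?_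
      refine (sum_half_pow_records_le n _).trans ?_
      refine mul_le_mul_of_nonneg_left (Real.sqrt_le_sqrt ?_) (by positivity)
      rw [card_map]
      gcongr
    have hu := sum_half_pow_union_le r K
      (mul_nonneg (Nat.cast_nonneg _) (Real.sqrt_nonneg _)) hr k ∅
    simp only [empty_union, card_empty, pow_zero, Nat.zero_le, if_true, mul_one] at hu
    calc _ ≤ ∑ c : Fin k → Equiv.Perm (Fin n), ((1 / 2 : ℝ) ^ K +
          (if #(univ.biUnion fun i => r (c i)) ≤ K then
            (1 / 2 : ℝ) ^ #(univ.biUnion fun i => r (c i)) else 0)) := by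
          refine sum_le_sum fun c _ => ?_
          have hle : (1 / 2 : ℝ) ^ #(undominatedCols
              (Fin.cons c₀ c : Fin (k + 1) → Equiv.Perm (Fin n))) ≤
              (1 / 2 : ℝ) ^ #(univ.biUnion fun i => r (c i)) :=
            pow_le_pow_of_le_one (by norm_num) (by norm_num)
              (card_le_card (records_subset_undominatedCols c₀ c))
          split_ifs with hK
          · exact hle.trans (le_add_of_nonneg_left (by positivity))
          · rw [add_zero]
            exact hle.trans
              (pow_le_pow_of_le_one (by norm_num) (by norm_num) (not_le.1 hK).le)
      _ ≤ _ := by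
          rw [sum_add_distrib]
          refine add_le_add (le_of_eq ?_) hu
          simp [Fintype.card_perm]
  refine (sum_le_sum fun c₀ _ => hmain c₀).trans (le_of_eq ?_)
  simp only [sum_const, card_univ, Fintype.card_perm, Fintype.card_fin, nsmul_eq_mul]
  ring

open Classical in
theorem card_dominated_on_le {m n : ℕ} {i i' : Fin m} (Y : Finset (Fin n)) (hY : Y.Nonempty) :
    (#{σ : Fin n → Equiv.Perm (Fin m) | ∀ j ∈ Y, σ j i < σ j i'} : ℝ) ≤
      m.factorial ^ n * (1 / 2) ^ #Y := by
  rcases eq_or_ne i i' with rfl | hne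
  · obtain ⟨j, hj⟩ := hY
    rw [filter_false_of_mem fun σ _ h => lt_irrefl _ (h j hj)]
    simp only [card_empty, Nat.cast_zero]
    positivity
  · have h1 := succ_mul_card_dominated_le (fun _ : Fin 1 => i) (fun _ => i')
      (Function.injective_of_subsingleton _) fun _ _ => hne.symm
    simp only [forall_const] at h1
    have h2 := pow_mul_card_forall_mem_le (ι := Fin n) _ Y (1 + 1)
      (h1.trans_eq (by rw [Fintype.card_perm, Fintype.card_fin]))
    rw [Fintype.card_perm, Fintype.card_fin, Fintype.card_fin] at h2
    simp only [mem_filter, mem_univ, true_and, Nat.reduceAdd] at h2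
    rw [one_div, inv_pow, ← div_eq_mul_inv, le_div_iff₀ (by positivity), mul_comm]
    have h3 : ((2 ^ #Y * #{σ : Fin n → Equiv.Perm (Fin m) | ∀ j ∈ Y, σ j i < σ j i'} : ℕ) : ℝ) ≤
        (m.factorial ^ n : ℕ) := by
      exact_mod_cast (by convert h2)
    exact_mod_cast h3

theorem undominatedCols_nonempty {m n : ℕ} (hm : 0 < m) (hn : 0 < n)
    (c : Fin m → Equiv.Perm (Fin n)) : (undominatedCols c).Nonempty := by
  have : Nonempty (Fin n) := ⟨⟨0, hn⟩⟩
  obtain ⟨j, -, hj⟩ := exists_max_image univ (c ⟨0, hm⟩) univ_nonempty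
  refine ⟨j, ?_⟩
  simp only [undominatedCols, mem_filter, mem_univ, true_and]
  rintro ⟨j', hj'⟩
  exact absurd (hj' ⟨0, hm⟩) (not_lt.2 (hj j' (mem_univ _)))

/-- The union bound over pairs of rows, one dominating the other on the undominated columns. -/
theorem probSolvable_le_sq_mul {k n : ℕ} (hk : 1 ≤ k) (hn : 0 < n) (K : ℕ) :
    probSolvable (k + 1) n ≤
      ((k + 1 : ℕ) : ℝ) ^ 2 * ((1 / 2) ^ K + √((K + 1) / (n + 1)) ^ k) := by
  classical
  set S := ∑ c : Fin (k + 1) → Equiv.Perm (Fin n), (1 / 2 : ℝ) ^ #(undominatedCols c)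
  let E : Fin (k + 1) × Fin (k + 1) → Finset (Omega (k + 1) n) := fun x =>
    {ω | ∀ j ∈ undominatedCols ω.2, ω.1 j x.1 < ω.1 j x.2}
  have hsub : ({ω | ω ∈ {ω : Omega (k + 1) n | GameSolvable ω}} : Finset (Omega (k + 1) n)) ⊆
      univ.biUnion E := by
    intro ω hω
    simp only [mem_filter, mem_univ, true_and, Set.mem_ofPred_eq] at hω
    obtain ⟨i, i', h⟩ := Solvable.exists_dominated (by omega) hω
    simp only [mem_biUnion, mem_univ, true_and]
    refine ⟨(i, i'), ?_⟩
    simp only [E, mem_filter, mem_univ, true_and]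
    intro j hj
    rw [← RPay_lt]
    refine h j ?_
    simp only [undominatedCols, mem_filter, mem_univ, true_and] at hj
    rintro ⟨j', -, hj'⟩
    exact hj ⟨j', fun i => (CPay_lt ω i j j').1 (hj' i (mem_univ _))⟩
  have hE : ∀ x, (#(E x) : ℝ) ≤ (k + 1).factorial ^ n * S := by
    intro x
    have h1 : (#(E x) : ℝ) = ∑ c : Fin (k + 1) → Equiv.Perm (Fin n),
        (#{σ : Fin n → Equiv.Perm (Fin (k + 1)) |
          ∀ j ∈ undominatedCols c, σ j x.1 < σ j x.2} : ℝ) := by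
      simp only [E, card_filter]
      rw [Fintype.sum_prod_type_right]
      push_cast
      rfl
    rw [h1, mul_sum]
    exact sum_le_sum fun c _ =>
      card_dominated_on_le _ (undominatedCols_nonempty (Nat.succ_pos k) hn c)
  rw [probSolvable, Pr_eq, div_le_iff₀ (by positivity)]
  calc _ ≤ ∑ x, (#(E x) : ℝ) := by
        exact_mod_cast (card_le_card hsub).trans card_biUnion_le
    _ ≤ ∑ _x : Fin (k + 1) × Fin (k + 1), ((k + 1).factorial : ℝ) ^ n * S :=
        sum_le_sum fun x _ => hE x
    _ = ((k + 1 : ℕ) : ℝ) ^ 2 * ((k + 1).factorial ^ n * S) := by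
        simp [sq]
    _ ≤ ((k + 1 : ℕ) : ℝ) ^ 2 * ((k + 1).factorial ^ n *
        (n.factorial ^ (k + 1) * ((1 / 2) ^ K + √((K + 1) / (n + 1)) ^ k))) := by
        have := sum_half_pow_undominatedCols_le k n K
        gcongr
    _ = _ := by ring

open Classical in
theorem mul_card_perm_apply_eq {n : ℕ} (j a : Fin n) :
    n * #{σ : Equiv.Perm (Fin n) | σ j = a} = n.factorial := by
  have h1 : ∀ b : Fin n, #{σ : Equiv.Perm (Fin n) | σ j = b} =
      #{σ : Equiv.Perm (Fin n) | σ j = a} := by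
    intro b
    refine card_equiv (Equiv.mulLeft (Equiv.swap a b)) fun σ => ?_
    simp only [mem_filter, mem_univ, true_and, Equiv.coe_mulLeft, Equiv.Perm.mul_apply]
    rw [Equiv.swap_apply_eq_iff, Equiv.swap_apply_left]
  have h2 := card_eq_sum_card_fiberwise (s := (univ : Finset (Equiv.Perm (Fin n))))
    (t := univ) (f := fun σ => σ j) fun _ _ => mem_coe.2 (mem_univ _)
  simp only [h1] at h2
  simpa [Fintype.card_perm] using h2.symm

theorem one_div_pow_le_probSolvable {m n : ℕ} (hm : 1 ≤ m) (hn : 1 ≤ n) :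
    1 / (n : ℝ) ^ (m - 1) ≤ probSolvable m n := by
  classical
  obtain ⟨k, rfl⟩ := Nat.exists_eq_add_of_le' hn
  let A : Fin (k + 1) → Finset (Equiv.Perm (Fin (k + 1))) := fun j => {σ | σ j = Fin.last k}
  let F : Fin (k + 1) → Finset (Fin m → Equiv.Perm (Fin (k + 1))) := fun j =>
    Fintype.piFinset fun _ => A j
  have hsub : {ω : Omega m (k + 1) | ω.2 ∈ univ.biUnion F} ⊆ {ω | GameSolvable ω} := by
    intro ω hω
    simp only [Set.mem_ofPred_eq, mem_biUnion, mem_univ, true_and, F, A, Fintype.mem_piFinset,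
      mem_filter] at hω
    obtain ⟨j, hj⟩ := hω
    refine solvable_of_dominant_column hm (by omega) j ?_ ?_
    · intro i i' h
      simpa [RPay, Fin.val_inj] using h
    · intro j' hj' i
      rw [CPay_lt, hj i, Fin.lt_last_iff_ne_last, ← hj i]
      exact fun e => hj' ((ω.2 i).injective e)
  refine le_trans ?_ (Pr_mono hsub)
  have hdisj : ((univ : Finset (Fin (k + 1))) : Set (Fin (k + 1))).PairwiseDisjoint F := by
    intro j _ j' _ hne
    refine Finset.disjoint_left.2 fun σ h h' => hne ?_
    simp only [F, A, Fintype.mem_piFinset, mem_filter, mem_univ, true_and] at h h'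
    exact (σ ⟨0, hm⟩).injective ((h ⟨0, hm⟩).trans (h' ⟨0, hm⟩).symm)
  have hfilter : ({σ | σ ∈ univ.biUnion F} : Finset (Fin m → Equiv.Perm (Fin (k + 1)))) =
      univ.biUnion F := by
    ext; simp
  rw [Pr_snd fun σ => σ ∈ univ.biUnion F, hfilter, card_biUnion hdisj]
  have hF : ∀ j, ((k + 1 : ℕ) : ℝ) ^ m * #(F j) = (k + 1).factorial ^ m := by
    intro j
    rw [Fintype.card_piFinset_const]
    push_cast
    rw [← mul_pow]
    congr 1
    exact_mod_cast mul_card_perm_apply_eq j (Fin.last k)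
  rw [le_div_iff₀ (by positivity), one_div_mul_eq_div, div_le_iff₀ (by positivity)]
  refine le_of_eq ?_
  push_cast
  rw [sum_mul]
  have hterm : ∀ j, (#(F j) : ℝ) * ((k : ℝ) + 1) ^ (m - 1) =
      (k + 1).factorial ^ m / (k + 1) := by
    intro j
    rw [eq_div_iff (by positivity), ← hF j, mul_assoc, ← pow_succ, Nat.sub_add_cancel hm]
    push_cast
    ring
  rw [sum_congr rfl fun j _ => hterm j]
  simp only [sum_const, card_univ, Fintype.card_fin, nsmul_eq_mul]
  push_cast
  field_simp

theorem two_pow_mul_pow_div_le {L y : ℝ} {q s m x : ℕ} (hL : 16 ≤ L) (hy : 0 ≤ y)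
    (hyL : y ≤ L ^ 32) (hq : 64 * q ≤ m) (hmx : m ≤ x) (hs : x ≤ 2 * s)
    (hqL : L ^ 8 ≤ 64 * (q + 1 : ℝ)) :
    2 ^ x * y ^ (2 * q) / (q + 1) ^ s ≤ 1 / L ^ m := by
  have hL0 : 0 < L := by linarith
  have hL1 : 1 ≤ L := by linarith
  have h6 : L ^ 6 ≤ (q + 1 : ℝ) := by
    have : 64 * L ^ 6 ≤ L ^ 8 := by
      have : (64 : ℝ) ≤ L ^ 2 := by nlinarith
      calc 64 * L ^ 6 ≤ L ^ 2 * L ^ 6 := by gcongr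
        _ = L ^ 8 := by ring
    linarith
  rw [div_le_div_iff₀ (by positivity) (by positivity), one_mul]
  calc 2 ^ x * y ^ (2 * q) * L ^ m ≤ L ^ x * L ^ x * L ^ x := by
        have h1 : (2 : ℝ) ^ x ≤ L ^ x := pow_le_pow_left₀ (by norm_num) (by linarith) _
        have h2 : y ^ (2 * q) ≤ L ^ x := by
          calc y ^ (2 * q) ≤ (L ^ 32) ^ (2 * q) := pow_le_pow_left₀ hy hyL _
            _ = L ^ (64 * q) := by rw [← pow_mul]; congr 1; ring
            _ ≤ L ^ x := pow_le_pow_right₀ hL1 (hq.trans hmx)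
        have h3 : L ^ m ≤ L ^ x := pow_le_pow_right₀ hL1 hmx
        gcongr
    _ = L ^ (3 * x) := by ring
    _ ≤ L ^ (6 * s) := pow_le_pow_right₀ hL1 (by omega)
    _ = (L ^ 6) ^ s := pow_mul _ _ _
    _ ≤ (q + 1) ^ s := pow_le_pow_left₀ (by positivity) h6 _

theorem probSolvable_le_of_le_pow {m n : ℕ} {L : ℝ} (hm : 2 ≤ m) (hmn : m ≤ n) (hL : 16 ≤ L)
    (hn : (n : ℝ) = L ^ 32) (hmL : L ^ 8 ≤ m) : probSolvable m n ≤ 2 * (1 / L ^ m) := by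
  have hq := Nat.div_mul_le_self m 64
  have hq' : m ≤ 64 * (m / 64 + 1) := by omega
  have hqL : L ^ 8 ≤ 64 * (((m / 64 : ℕ) : ℝ) + 1) := hmL.trans (by exact_mod_cast hq')
  have hm' : (m : ℝ) ≤ L ^ 32 := hn ▸ (by exact_mod_cast hmn)
  refine (probSolvable_le_of_two_mul_le (q := m / 64) (s := (n + 1) / 2) (t := (m + 1) / 2)
    hm (by omega) (by omega) (by omega) (by omega)).trans ?_
  rw [two_mul (1 / L ^ m)]
  exact add_le_add
    (two_pow_mul_pow_div_le (m := m) (q := m / 64) (s := (n + 1) / 2) hL (Nat.cast_nonneg _) hm'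
      (by omega) hmn (by omega) hqL)
    (two_pow_mul_pow_div_le (m := m) (q := m / 64) (s := (m + 1) / 2) hL (Nat.cast_nonneg _) hn.le
      (by omega) le_rfl (by omega) hqL)

theorem probSolvable_le_of_pow_le {m n : ℕ} {L : ℝ} (hm : 2 ≤ m) (hL : 16 ≤ L)
    (hn : (n : ℝ) = L ^ 32) (hmL : m ≤ L ^ 8) : probSolvable m n ≤ 2 * (1 / L ^ m) := by
  have hL0 : 0 < L := by linarith
  have hL1 : 1 ≤ L := by linarith
  obtain ⟨k, rfl⟩ := Nat.exists_eq_add_of_le' (show 1 ≤ m by omega)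
  have hn0 : 0 < n := by
    have : (0 : ℝ) < n := hn ▸ by positivity
    exact_mod_cast this
  set K := Nat.sqrt n with hK
  have hKle : (K : ℝ) ≤ L ^ 16 := by
    have h1 : ((K * K : ℕ) : ℝ) ≤ n := by exact_mod_cast Nat.sqrt_le n
    push_cast at h1
    refine abs_le_of_sq_le_sq' ?_ (by positivity) |>.2
    nlinarith
  have hleK : L ^ 16 ≤ (K : ℝ) + 1 := by
    have h1 : (n : ℝ) ≤ ((K + 1) * (K + 1) : ℕ) := by exact_mod_cast (Nat.lt_succ_sqrt n).le
    push_cast at h1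
    refine abs_le_of_sq_le_sq' ?_ (by positivity) |>.2
    nlinarith
  have hsq : ((k + 1 : ℕ) : ℝ) ^ 2 ≤ L ^ (k + 1) := by
    have h1 : ((k + 1 : ℕ) : ℝ) ≤ 2 ^ (k + 1) := by exact_mod_cast Nat.lt_two_pow_self.le
    calc ((k + 1 : ℕ) : ℝ) ^ 2 ≤ (2 ^ (k + 1)) ^ 2 := by gcongr
      _ = 4 ^ (k + 1) := by rw [← pow_mul, mul_comm, pow_mul]; norm_num
      _ ≤ L ^ (k + 1) := by gcongr; linarith
  have hroot : √(((K : ℝ) + 1) / (n + 1)) ≤ 1 / L ^ 7 := by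
    apply Real.sqrt_le_iff.2 ⟨by positivity, ?_⟩
    rw [div_pow, one_pow, ← pow_mul, div_le_div_iff₀ (by positivity) (by positivity), one_mul, hn]
    have h1 : (K : ℝ) + 1 ≤ L ^ 2 * L ^ 16 := by
      have : 1 ≤ L ^ 16 := one_le_pow₀ hL1
      have : 2 ≤ L ^ 2 := by nlinarith
      nlinarith
    calc ((K : ℝ) + 1) * L ^ (7 * 2) ≤ L ^ 2 * L ^ 16 * L ^ (7 * 2) := by gcongr
      _ ≤ L ^ 32 + 1 := by ring_nf; linarith
  have hhalf : (1 / 2 : ℝ) ^ K ≤ 1 / L ^ (2 * (k + 1)) := by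
    rw [one_div_pow]
    refine one_div_le_one_div_of_le (by positivity) ?_
    have hceil : L ≤ 2 ^ ⌈L⌉₊ :=
      (Nat.le_ceil L).trans (by exact_mod_cast Nat.lt_two_pow_self.le)
    have hexp : ⌈L⌉₊ * (2 * (k + 1)) ≤ K := by
      have h1 : (⌈L⌉₊ : ℝ) ≤ L + 1 := (Nat.ceil_lt_add_one hL0.le).le
      have h2 : (⌈L⌉₊ : ℝ) * (2 * ((k + 1 : ℕ) : ℝ)) ≤ K := by
        calc (⌈L⌉₊ : ℝ) * (2 * ((k + 1 : ℕ) : ℝ)) ≤ (2 * L) * (2 * L ^ 8) := by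
              gcongr; linarith
          _ = 4 * L ^ 9 := by ring
          _ ≤ L ^ 16 - 1 := by
              have h3 : 1 ≤ L ^ 9 := one_le_pow₀ hL1
              have h4 : 5 ≤ L ^ 7 := by
                calc (5 : ℝ) ≤ L := by linarith
                  _ ≤ L ^ 7 := le_self_pow₀ hL1 (by norm_num)
              have h5 : L ^ 16 = L ^ 7 * L ^ 9 := by ring
              nlinarith
          _ ≤ K := by linarith
      exact_mod_cast h2
    calc L ^ (2 * (k + 1)) ≤ (2 ^ ⌈L⌉₊) ^ (2 * (k + 1)) := by gcongr
      _ = 2 ^ (⌈L⌉₊ * (2 * (k + 1))) := (pow_mul _ _ _).symm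
      _ ≤ 2 ^ K := pow_le_pow_right₀ (by norm_num) hexp
  have hpow : √(((K : ℝ) + 1) / (n + 1)) ^ k ≤ 1 / L ^ (2 * (k + 1)) := by
    calc √(((K : ℝ) + 1) / (n + 1)) ^ k ≤ (1 / L ^ 7) ^ k := by gcongr
      _ = 1 / L ^ (7 * k) := by rw [one_div_pow, ← pow_mul]
      _ ≤ 1 / L ^ (2 * (k + 1)) :=
        one_div_le_one_div_of_le (by positivity) (pow_le_pow_right₀ hL1 (by omega))
  calc probSolvable (k + 1) n ≤ _ := probSolvable_le_sq_mul (by omega) hn0 K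
    _ ≤ L ^ (k + 1) * (1 / L ^ (2 * (k + 1)) + 1 / L ^ (2 * (k + 1))) := by gcongr
    _ = 2 * (1 / L ^ (k + 1)) := by
      rw [two_mul (k + 1), pow_add]
      field_simp
      ring

theorem exists_forall_probSolvable_le :
    ∃ N : ℕ, ∀ m n : ℕ, 2 ≤ m → m ≤ n → N ≤ n →
      probSolvable m n ≤ 2 * (n : ℝ) ^ (-(1 / 32 * (m : ℝ))) := by
  refine ⟨16 ^ 32, fun m n hm hmn hN => ?_⟩
  set L : ℝ := (n : ℝ) ^ (1 / 32 : ℝ) with hLdef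
  have hn : (n : ℝ) = L ^ 32 := by
    rw [hLdef, ← Real.rpow_natCast, ← Real.rpow_mul (Nat.cast_nonneg n)]
    norm_num
  have hL0 : 0 ≤ L := by positivity
  have hL : 16 ≤ L := by
    have h1 : (16 : ℝ) ^ 32 ≤ L ^ 32 := hn ▸ (by exact_mod_cast hN)
    exact le_of_pow_le_pow_left₀ (by norm_num) hL0 h1
  have hLm : (n : ℝ) ^ (-(1 / 32 * (m : ℝ))) = 1 / L ^ m := by
    rw [Real.rpow_neg (Nat.cast_nonneg n), Real.rpow_mul (Nat.cast_nonneg n), Real.rpow_natCast,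
      one_div (L ^ m)]
  rw [hLm]
  rcases le_total (L ^ 8) m with h | h
  · exact probSolvable_le_of_le_pow hm hmn hL hn h
  · exact probSolvable_le_of_pow_le hm hL hn h

/-- There exist constants `C₁, C₂ > 0` such that for all `2 ≤ m ≤ n`,
`n^(−(m−1)) ≤ π(m,n) ≤ C₁·n^(−C₂·m)`. -/
theorem stmt15 :
    ∃ C₁ : ℝ, 0 < C₁ ∧ ∃ C₂ : ℝ, 0 < C₂ ∧ ∀ m n : ℕ, 2 ≤ m → m ≤ n →
      1 / (n : ℝ) ^ (m - 1) ≤ probSolvable m n ∧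
      probSolvable m n ≤ C₁ * (n : ℝ) ^ (-(C₂ * (m : ℝ))) := by
  obtain ⟨N, hN⟩ := exists_forall_probSolvable_le
  refine ⟨2 + (N : ℝ) ^ N, by positivity, 1 / 32, by norm_num, fun m n hm hmn =>
    ⟨one_div_pow_le_probSolvable (by omega) (by omega), ?_⟩⟩
  have hn1 : (1 : ℝ) ≤ n := by exact_mod_cast (show 1 ≤ n by omega)
  rcases le_or_gt N n with hNn | hnN
  · refine (hN m n hm hmn hNn).trans (mul_le_mul_of_nonneg_right ?_ (by positivity))
    exact le_add_of_nonneg_right (by positivity)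
  · refine (Pr_le_one _).trans ?_
    rw [Real.rpow_neg (Nat.cast_nonneg n), ← div_eq_mul_inv, le_div_iff₀ (by positivity), one_mul]
    calc (n : ℝ) ^ (1 / 32 * (m : ℝ)) ≤ (n : ℝ) ^ (m : ℝ) :=
          Real.rpow_le_rpow_of_exponent_le hn1
            (by linarith [(Nat.cast_nonneg m : (0 : ℝ) ≤ m)])
      _ = ((n ^ m : ℕ) : ℝ) := by rw [Real.rpow_natCast]; push_cast; rfl
      _ ≤ ((N ^ N : ℕ) : ℝ) := by
          refine Nat.cast_le.2 ((Nat.pow_le_pow_left hnN.le m).trans ?_)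
          exact Nat.pow_le_pow_right (by omega) (by omega)
      _ ≤ 2 + (N : ℝ) ^ N := by push_cast; linarith
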